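/- Consider the flexible Gumbel (FG) modal regression model: for an n × p real design matrix X of full rank with p ≤ n and finite entries, with rows X₁ᵀ, …, X_nᵀ, observations y₁, …, y_n ∈ ℝ, the likelihood ∏_{i=1}^{n} f_FG(y_i | w, X_iᵀβ, σ₁, σ₂), the Uniform(0,1) prior density on w, independent InverseGamma(1,1) prior densities p(σ₁) = σ₁^{−2} e^{−1/σ₁} and p(σ₂) = σ₂^{−2} e^{−1/σ₂} on σ₁, σ₂ > 0, and the flat prior p(β) ∝ 1 on β ∈ ℝ^p. Then the posterior distribution is proper, i.e., ∫₀^∞ ∫₀^∞ ∫₀^1 ∫_{ℝ^p} ∏_{i=1}^{n} f_FG(y_i | w, X_iᵀβ, σ₁, σ₂) p(σ₁) p(σ₂) dβ dw dσ₁ dσ₂ < ∞. -/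

import Mathlib

open MeasureTheory

/-- The Gumbel density with location `θ` and scale `σ`. -/
noncomputable def fGumbel (θ σ y : ℝ) : ℝ :=
  (1 / σ) * Real.exp (-(y - θ) / σ - Real.exp (-(y - θ) / σ))

/-- The flexible Gumbel (FG) density with weight `w`, mode `θ`, and scales `σ₁, σ₂`. -/
noncomputable def fFG (w θ σ₁ σ₂ y : ℝ) : ℝ :=
  w * fGumbel (-θ) σ₁ (-y) + (1 - w) * fGumbel θ σ₂ y

/-- The InverseGamma(1,1) density. -/
noncomputable def invGamma11 (x : ℝ) : ℝ := x ^ (-2 : ℝ) * Real.exp (-1 / x)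

/-- The standard Gumbel density, reflected, is integrable. -/
lemma integrable_exp_sub_exp : Integrable (fun t : ℝ => Real.exp (t - Real.exp t)) := by
  have hm : ∀ s : Set ℝ, AEStronglyMeasurable (fun t : ℝ => Real.exp (t - Real.exp t))
      (volume.restrict s) := fun s => by
    have : Continuous (fun t : ℝ => Real.exp (t - Real.exp t)) := by fun_prop
    exact this.aestronglyMeasurable
  rw [← integrableOn_univ, ← Set.Iic_union_Ioi (a := (0 : ℝ))]
  refine IntegrableOn.union ?_ ?_
  · refine Integrable.mono' (integrableOn_exp_Iic 0) (hm _) (ae_of_all _ fun t => ?_)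
    rw [Real.norm_eq_abs, Real.abs_exp]
    exact Real.exp_le_exp.2 (by linarith [Real.exp_pos t])
  · refine Integrable.mono' (integrableOn_exp_neg_Ioi 0) (hm _) (ae_of_all _ fun t => ?_)
    rw [Real.norm_eq_abs, Real.abs_exp]
    exact Real.exp_le_exp.2 (by linarith [Real.two_mul_le_exp (x := t)])

lemma fGumbel_eq (θ σ y : ℝ) :
    fGumbel θ σ y = (1 / σ) * Real.exp ((θ - y) / σ - Real.exp ((θ - y) / σ)) := by
  simp only [fGumbel, neg_sub]

lemma fGumbel_nonneg {σ : ℝ} (hσ : 0 < σ) (θ y : ℝ) : 0 ≤ fGumbel θ σ y := by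
  unfold fGumbel; positivity

lemma fGumbel_le {σ : ℝ} (hσ : 0 < σ) (θ y : ℝ) : fGumbel θ σ y ≤ 1 / σ := by
  rw [fGumbel_eq]
  refine mul_le_of_le_one_right (by positivity) ?_
  rw [Real.exp_le_one_iff]
  linarith [Real.add_one_le_exp ((θ - y) / σ)]

lemma integrable_fGumbel {σ : ℝ} (hσ : 0 < σ) (y : ℝ) :
    Integrable (fun θ => fGumbel θ σ y) := by
  simp only [fGumbel_eq]
  exact ((integrable_exp_sub_exp.comp_div hσ.ne').comp_sub_right y).const_mul _

lemma integral_fGumbel {σ : ℝ} (hσ : 0 < σ) (y : ℝ) :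
    ∫ θ, fGumbel θ σ y = ∫ t : ℝ, Real.exp (t - Real.exp t) := by
  simp only [fGumbel_eq]
  rw [integral_const_mul,
    integral_sub_right_eq_self (fun u => Real.exp (u / σ - Real.exp (u / σ))) y,
    Measure.integral_comp_div (fun u => Real.exp (u - Real.exp u)) σ, abs_of_pos hσ,
    smul_eq_mul, ← mul_assoc, one_div_mul_cancel hσ.ne', one_mul]

/-- The unweighted sum of the two components of the FG density. -/
noncomputable def gumbelSum (σ₁ σ₂ y θ : ℝ) : ℝ :=
  fGumbel (-θ) σ₁ (-y) + fGumbel θ σ₂ y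

lemma gumbelSum_nonneg {σ₁ σ₂ : ℝ} (h₁ : 0 < σ₁) (h₂ : 0 < σ₂) (y θ : ℝ) :
    0 ≤ gumbelSum σ₁ σ₂ y θ :=
  add_nonneg (fGumbel_nonneg h₁ _ _) (fGumbel_nonneg h₂ _ _)

lemma gumbelSum_le {σ₁ σ₂ : ℝ} (h₁ : 0 < σ₁) (h₂ : 0 < σ₂) (y θ : ℝ) :
    gumbelSum σ₁ σ₂ y θ ≤ (1 + 1 / σ₁) * (1 + 1 / σ₂) := by
  have := fGumbel_le h₁ (-θ) (-y)
  have := fGumbel_le h₂ θ y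
  have : 0 ≤ 1 / σ₁ * (1 / σ₂) := by positivity
  unfold gumbelSum
  nlinarith

lemma integrable_gumbelSum {σ₁ σ₂ : ℝ} (h₁ : 0 < σ₁) (h₂ : 0 < σ₂) (y : ℝ) :
    Integrable (gumbelSum σ₁ σ₂ y) :=
  (integrable_fGumbel h₁ (-y)).comp_neg.add (integrable_fGumbel h₂ y)

lemma integral_gumbelSum {σ₁ σ₂ : ℝ} (h₁ : 0 < σ₁) (h₂ : 0 < σ₂) (y : ℝ) :
    ∫ θ, gumbelSum σ₁ σ₂ y θ = 2 * ∫ t : ℝ, Real.exp (t - Real.exp t) := by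
  unfold gumbelSum
  rw [integral_add (integrable_fGumbel h₁ (-y)).comp_neg (integrable_fGumbel h₂ y),
    integral_neg_eq_self (fun θ => fGumbel θ σ₁ (-y)), integral_fGumbel h₁, integral_fGumbel h₂,
    two_mul]

lemma fFG_nonneg {σ₁ σ₂ : ℝ} (h₁ : 0 < σ₁) (h₂ : 0 < σ₂) {w : ℝ}
    (hw : w ∈ Set.Ioo (0 : ℝ) 1) (θ y : ℝ) : 0 ≤ fFG w θ σ₁ σ₂ y :=
  add_nonneg (mul_nonneg hw.1.le (fGumbel_nonneg h₁ _ _))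
    (mul_nonneg (sub_nonneg.2 hw.2.le) (fGumbel_nonneg h₂ _ _))

lemma fFG_le_gumbelSum {σ₁ σ₂ : ℝ} (h₁ : 0 < σ₁) (h₂ : 0 < σ₂) {w : ℝ}
    (hw : w ∈ Set.Ioo (0 : ℝ) 1) (θ y : ℝ) :
    fFG w θ σ₁ σ₂ y ≤ gumbelSum σ₁ σ₂ y θ :=
  add_le_add (mul_le_of_le_one_left (fGumbel_nonneg h₁ _ _) hw.2.le)
    (mul_le_of_le_one_left (fGumbel_nonneg h₂ _ _) (by linarith [hw.1]))

/-- Over a subfamily of observations indexed by an invertible square block of the design matrix,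
the product of the component sums has an integral that does not depend on the scales. -/
lemma lintegral_prod_gumbelSum {σ₁ σ₂ : ℝ} (h₁ : 0 < σ₁) (h₂ : 0 < σ₂)
    {p : ℕ} {M : Matrix (Fin p) (Fin p) ℝ} (hM : M.det ≠ 0)
    (z : Fin p → ℝ) :
    ∫⁻ β : Fin p → ℝ, ENNReal.ofReal (∏ i, gumbelSum σ₁ σ₂ (z i) (∑ j, M i j * β j)) =
      ENNReal.ofReal |M.det⁻¹| *
        ENNReal.ofReal ((2 * ∫ t : ℝ, Real.exp (t - Real.exp t)) ^ p) := by
  have hmeas : Measurable fun v : Fin p → ℝ =>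
      ENNReal.ofReal (∏ i, gumbelSum σ₁ σ₂ (z i) (v i)) := by
    unfold gumbelSum fGumbel
    fun_prop
  have hlin : Measurable (Matrix.toLin' M) :=
    (LinearMap.continuous_of_finiteDimensional _).measurable
  have key : ∫⁻ v : Fin p → ℝ, ENNReal.ofReal (∏ i, gumbelSum σ₁ σ₂ (z i) (v i)) =
      ENNReal.ofReal ((2 * ∫ t : ℝ, Real.exp (t - Real.exp t)) ^ p) := by
    rw [volume_pi, ← ofReal_integral_eq_lintegral_ofReal
      (Integrable.fintype_prod fun i => integrable_gumbelSum h₁ h₂ (z i))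
      (ae_of_all _ fun v => Finset.prod_nonneg fun i _ => gumbelSum_nonneg h₁ h₂ _ _),
      integral_fintype_prod_eq_prod (fun i => gumbelSum σ₁ σ₂ (z i))]
    simp [integral_gumbelSum h₁ h₂]
  have := lintegral_map (μ := volume) hmeas hlin
  rw [Real.map_matrix_volume_pi_eq_smul_volume_pi hM, lintegral_smul_measure, key] at this
  simpa [Matrix.mulVec, dotProduct] using this.symm

/-- The likelihood is dominated by the product over any subfamily of the observations, times a
power of a bound on the densities. -/
lemma prod_fFG_le {σ₁ σ₂ : ℝ} (h₁ : 0 < σ₁) (h₂ : 0 < σ₂)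
    {ι κ : Type*} [Fintype ι] [Fintype κ] {w : ℝ} (hw : w ∈ Set.Ioo (0 : ℝ) 1)
    {e : κ → ι} (he : Function.Injective e) (θ y : ι → ℝ) :
    ∏ i, fFG w (θ i) σ₁ σ₂ (y i) ≤
      (∏ k, gumbelSum σ₁ σ₂ (y (e k)) (θ (e k))) *
        ((1 + 1 / σ₁) * (1 + 1 / σ₂)) ^ Fintype.card ι := by
  classical
  have hB : 1 ≤ (1 + 1 / σ₁) * (1 + 1 / σ₂) :=
    one_le_mul_of_one_le_of_one_le (by simp [h₁.le]) (by simp [h₂.le])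
  rw [← Finset.prod_mul_prod_compl (Finset.univ.image e), Finset.prod_image he.injOn]
  refine mul_le_mul
    (Finset.prod_le_prod (fun k _ => fFG_nonneg h₁ h₂ hw _ _)
      fun k _ => fFG_le_gumbelSum h₁ h₂ hw _ _) ?_
    (Finset.prod_nonneg fun k _ => fFG_nonneg h₁ h₂ hw _ _)
    (Finset.prod_nonneg fun k _ => gumbelSum_nonneg h₁ h₂ _ _)
  calc _ ≤ ∏ _i ∈ (Finset.univ.image e)ᶜ, (1 + 1 / σ₁) * (1 + 1 / σ₂) :=
        Finset.prod_le_prod (fun i _ => fFG_nonneg h₁ h₂ hw _ _) fun i _ =>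
          (fFG_le_gumbelSum h₁ h₂ hw _ _).trans (gumbelSum_le h₁ h₂ _ _)
    _ ≤ _ := by
        rw [Finset.prod_const]
        exact pow_le_pow_right₀ hB (Finset.card_le_univ _)

/-- A matrix of full column rank has an invertible square block made of distinct rows. -/
lemma exists_injective_det_submatrix_ne_zero {n p : ℕ} {X : Matrix (Fin n) (Fin p) ℝ}
    (hrank : X.rank = p) :
    ∃ e : Fin p → Fin n, Function.Injective e ∧ (X.submatrix e id).det ≠ 0 := by
  obtain ⟨f, hf, -, hli⟩ := Submodule.exists_fun_fin_finrank_span_eq ℝ (Set.range X.row)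
  have hfr : p = Module.finrank ℝ (Submodule.span ℝ (Set.range X.row)) := by
    rw [← Matrix.rank_eq_finrank_span_row, hrank]
  choose e he using hf
  obtain rfl : X.row ∘ e = f := funext he
  have hli' := hli.comp (finCongr hfr) (finCongr hfr).injective
  refine ⟨e ∘ finCongr hfr, Function.Injective.of_comp hli'.injective, ?_⟩
  exact ((Matrix.isUnit_iff_isUnit_det _).1
    (Matrix.linearIndependent_rows_iff_isUnit.1 hli')).ne_zero

lemma invGamma11_nonneg {x : ℝ} (hx : 0 < x) : 0 ≤ invGamma11 x := by
  unfold invGamma11; positivity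

/-- Inverse moments of the InverseGamma(1,1) distribution are finite. -/
lemma lintegral_one_add_inv_pow_mul_invGamma11_lt_top (m : ℕ) :
    ∫⁻ σ in Set.Ioi (0 : ℝ), ENNReal.ofReal ((1 + 1 / σ) ^ m * invGamma11 σ) < ⊤ := by
  rw [← Set.Ioc_union_Ioi_eq_Ioi (zero_le_one' ℝ)]
  refine (lintegral_union_le _ _ _).trans_lt (ENNReal.add_lt_top.2 ⟨?_, ?_⟩)
  · have hb : ∀ σ ∈ Set.Ioc (0 : ℝ) 1, (1 + 1 / σ) ^ m * invGamma11 σ ≤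
        (m + 2).factorial * Real.exp 1 := by
      rintro σ ⟨h0, -⟩
      have hu : 0 ≤ 1 / σ := by positivity
      have h1 := Real.pow_div_factorial_le_exp (1 + 1 / σ) (add_nonneg zero_le_one hu) (m + 2)
      rw [div_le_iff₀ (by positivity)] at h1
      have h2 : σ ^ (-2 : ℝ) = (1 / σ) ^ 2 := by
        rw [Real.rpow_neg h0.le]; norm_num
      calc (1 + 1 / σ) ^ m * invGamma11 σ
          = (1 + 1 / σ) ^ m * (1 / σ) ^ 2 * Real.exp (-1 / σ) := by
            rw [invGamma11, h2, mul_assoc]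
        _ ≤ (1 + 1 / σ) ^ m * (1 + 1 / σ) ^ 2 * Real.exp (-1 / σ) := by
            gcongr; linarith
        _ ≤ Real.exp (1 + 1 / σ) * (m + 2).factorial * Real.exp (-1 / σ) := by
            rw [← pow_add]; gcongr
        _ = (m + 2).factorial * (Real.exp (1 + 1 / σ) * Real.exp (-1 / σ)) := by ring
        _ = (m + 2).factorial * Real.exp 1 := by
            rw [← Real.exp_add]; congr 2; ring
    refine (setLIntegral_mono' measurableSet_Ioc fun σ hσ =>
      ENNReal.ofReal_le_ofReal (hb σ hσ)).trans_lt ?_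
    rw [setLIntegral_const]
    exact ENNReal.mul_lt_top ENNReal.ofReal_lt_top (by simp)
  · have hb : ∀ σ ∈ Set.Ioi (1 : ℝ), (1 + 1 / σ) ^ m * invGamma11 σ ≤
        2 ^ m * σ ^ (-2 : ℝ) := by
      intro σ hσ
      have h1 : (1 : ℝ) < σ := hσ
      have h0 : 0 < σ := zero_lt_one.trans h1
      have hu : 1 / σ ≤ 1 := by rw [div_le_one h0]; exact h1.le
      have he : Real.exp (-1 / σ) ≤ 1 := by
        rw [Real.exp_le_one_iff, neg_div]
        simpa using h0.le
      have h2 : 0 ≤ σ ^ (-2 : ℝ) := by positivity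
      unfold invGamma11
      gcongr
      · linarith
      · exact mul_le_of_le_one_right h2 he
    refine (setLIntegral_mono' measurableSet_Ioi fun σ hσ =>
      ENNReal.ofReal_le_ofReal (hb σ hσ)).trans_lt ?_
    exact ((integrableOn_Ioi_rpow_of_lt (by norm_num) zero_lt_one).const_mul
      (2 ^ m)).lintegral_lt_top

/-- Posterior propriety of the FG modal regression model. -/
theorem posterior_propriety_FG
    (n p : ℕ) (hpn : p ≤ n)
    (X : Matrix (Fin n) (Fin p) ℝ) (hrank : X.rank = p)
    (y : Fin n → ℝ) :
    ∫⁻ σ₁ in Set.Ioi (0:ℝ), ∫⁻ σ₂ in Set.Ioi (0:ℝ), ∫⁻ w in Set.Ioo (0:ℝ) 1,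
      ∫⁻ β : Fin p → ℝ,
        ENNReal.ofReal ((∏ i, fFG w (∑ j, X i j * β j) σ₁ σ₂ (y i)) *
          invGamma11 σ₁ * invGamma11 σ₂) < ⊤ := by
  obtain ⟨e, he, hdet⟩ := exists_injective_det_submatrix_ne_zero hrank
  set C : ENNReal := ENNReal.ofReal |(X.submatrix e id).det⁻¹| *
    ENNReal.ofReal ((2 * ∫ t : ℝ, Real.exp (t - Real.exp t)) ^ p)
  have hCtop : C < ⊤ := ENNReal.mul_lt_top ENNReal.ofReal_lt_top ENNReal.ofReal_lt_top
  set g : ℝ → ENNReal := fun σ => ENNReal.ofReal ((1 + 1 / σ) ^ n * invGamma11 σ) with hg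
  have hJ : ∫⁻ σ in Set.Ioi (0 : ℝ), g σ < ⊤ :=
    lintegral_one_add_inv_pow_mul_invGamma11_lt_top n
  have hβ : ∀ σ₁ ∈ Set.Ioi (0 : ℝ), ∀ σ₂ ∈ Set.Ioi (0 : ℝ), ∀ w ∈ Set.Ioo (0 : ℝ) 1,
      ∫⁻ β : Fin p → ℝ, ENNReal.ofReal ((∏ i, fFG w (∑ j, X i j * β j) σ₁ σ₂ (y i)) *
        invGamma11 σ₁ * invGamma11 σ₂) ≤ C * g σ₁ * g σ₂ := by
    intro σ₁ h₁ σ₂ h₂ w hw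
    have i₁ := invGamma11_nonneg h₁
    have i₂ := invGamma11_nonneg h₂
    have p₁ : 0 ≤ (1 + 1 / σ₁) ^ n * invGamma11 σ₁ := by
      have : (0 : ℝ) < σ₁ := h₁
      positivity
    calc _ ≤ ∫⁻ β : Fin p → ℝ, ENNReal.ofReal (∏ k, gumbelSum σ₁ σ₂ (y (e k))
              (∑ j, X.submatrix e id k j * β j)) * (g σ₁ * g σ₂) := by
          refine lintegral_mono fun β => ?_
          rw [hg, ← ENNReal.ofReal_mul p₁, ← ENNReal.ofReal_mul
            (Finset.prod_nonneg fun k _ => gumbelSum_nonneg h₁ h₂ _ _)]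
          refine ENNReal.ofReal_le_ofReal ?_
          have := prod_fFG_le h₁ h₂ hw he (fun i => ∑ j, X i j * β j) y
          rw [Fintype.card_fin, mul_pow] at this
          refine (mul_le_mul_of_nonneg_right (mul_le_mul_of_nonneg_right this i₁) i₂).trans_eq ?_
          simp only [Matrix.submatrix_apply, id]
          ring
      _ = C * g σ₁ * g σ₂ := by
          rw [lintegral_mul_const' _ _ (ENNReal.mul_ne_top ENNReal.ofReal_ne_top
            ENNReal.ofReal_ne_top), lintegral_prod_gumbelSum h₁ h₂ hdet, mul_assoc C]
  calc _ ≤ ∫⁻ σ₁ in Set.Ioi (0 : ℝ), C * g σ₁ * ∫⁻ σ₂ in Set.Ioi (0 : ℝ), g σ₂ := by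
        refine setLIntegral_mono' measurableSet_Ioi fun σ₁ h₁ => ?_
        rw [← lintegral_const_mul' _ _ (ENNReal.mul_ne_top hCtop.ne ENNReal.ofReal_ne_top)]
        refine setLIntegral_mono' measurableSet_Ioi fun σ₂ h₂ => ?_
        refine (setLIntegral_mono' measurableSet_Ioo (hβ σ₁ h₁ σ₂ h₂)).trans_eq ?_
        rw [setLIntegral_const, Real.volume_Ioo, sub_zero, ENNReal.ofReal_one, mul_one]
    _ = C * (∫⁻ σ in Set.Ioi (0 : ℝ), g σ) * ∫⁻ σ in Set.Ioi (0 : ℝ), g σ := by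
        rw [lintegral_mul_const' _ _ hJ.ne, lintegral_const_mul' _ _ hCtop.ne]
    _ < ⊤ := ENNReal.mul_lt_top (ENNReal.mul_lt_top hCtop hJ) hJ
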